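/- For a unit-speed C¹ loop γ ∈ N, let K(γ) = {(γ(t), γ'(t)) : t ∈ ℝ/ℤ} ∪ {(γ(t), −γ'(t)) : t ∈ ℝ/ℤ} ⊆ ℝ² × ℝ² be the unitary tangent bundle of its image (a compact subset of ℝ² × ℝ²). Let γ and γₙ (n ∈ ℕ) be injective elements of N. Then δ([γₙ], [γ]) → 0 as n → ∞ if and only if d_H(K(γₙ), K(γ)) → 0, where d_H denotes the Hausdorff distance on nonempty compact subsets of ℝ² × ℝ². Hence the metric α(B₁, B₂) = d_H(K(B₁), K(B₂)) is topologically equivalent to δ on the set of embedded unit-speed C¹ loops modulo isometric reparametrization. -/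

import Mathlib

open scoped Topology
open Filter

/-- `Γ`: the space of `C¹` loops `γ : ℝ/ℤ → ℝ²`, seen as 1-periodic `C¹` maps `ℝ → ℝ²`. -/
def InGamma (γ : ℝ → EuclideanSpace ℝ (Fin 2)) : Prop :=
  ContDiff ℝ 1 γ ∧ Function.Periodic γ 1

/-- The distance on `Γ` induced by the C¹ norm `‖γ‖ = ‖γ‖_∞ + ‖γ'‖_∞`. -/
noncomputable def dC1 (γ₁ γ₂ : ℝ → EuclideanSpace ℝ (Fin 2)) : ℝ :=
  (⨆ t : ℝ, dist (γ₁ t) (γ₂ t)) + (⨆ t : ℝ, dist (deriv γ₁ t) (deriv γ₂ t))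

/-- `N`: the set of unit-speed parametrizations in `Γ`. -/
def InN (γ : ℝ → EuclideanSpace ℝ (Fin 2)) : Prop :=
  InGamma γ ∧ ∀ t : ℝ, ‖deriv γ t‖ = 1

/-- Injectivity of a 1-periodic loop as a map on the circle `ℝ/ℤ`. -/
def InjLoop (γ : ℝ → EuclideanSpace ℝ (Fin 2)) : Prop :=
  ∀ s t : ℝ, γ s = γ t → ∃ k : ℤ, s - t = (k : ℝ)

/-- `γ₁ ∼ γ₂` iff `γ₁ = γ₂ ∘ u` for an isometry `u : t ↦ εt + c` of `ℝ`, `ε = ±1`. -/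
def LoopRel (γ₁ γ₂ : ℝ → EuclideanSpace ℝ (Fin 2)) : Prop :=
  ∃ ε c : ℝ, (ε = 1 ∨ ε = -1) ∧ ∀ t : ℝ, γ₁ t = γ₂ (ε * t + c)

/-- `δ([γ₁], [γ₂]) = inf { d(g₁, g₂) : g₁ ∈ [γ₁], g₂ ∈ [γ₂] }`. -/
noncomputable def deltaDist (γ₁ γ₂ : ℝ → EuclideanSpace ℝ (Fin 2)) : ℝ :=
  sInf {r : ℝ | ∃ g₁ g₂ : ℝ → EuclideanSpace ℝ (Fin 2),
    LoopRel g₁ γ₁ ∧ LoopRel g₂ γ₂ ∧ r = dC1 g₁ g₂}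

/-- `K(γ) = {(γ(t), ±γ'(t))} ⊆ ℝ² × ℝ²`, the unitary tangent bundle of the image of `γ`. -/
def Kset (γ : ℝ → EuclideanSpace ℝ (Fin 2)) :
    Set (EuclideanSpace ℝ (Fin 2) × EuclideanSpace ℝ (Fin 2)) :=
  {p | ∃ t : ℝ, p = (γ t, deriv γ t)} ∪ {p | ∃ t : ℝ, p = (γ t, -deriv γ t)}


abbrev E2 := EuclideanSpace ℝ (Fin 2)

/-- distance to the nearest integer -/
noncomputable def nrm (x : ℝ) : ℝ := ‖(x : UnitAddCircle)‖

lemma nrm_nonneg (x : ℝ) : 0 ≤ nrm x := norm_nonneg _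

lemma nrm_add_le (x y : ℝ) : nrm (x + y) ≤ nrm x + nrm y := by
  unfold nrm
  rw [AddCircle.coe_add]
  exact norm_add_le _ _

lemma nrm_neg (x : ℝ) : nrm (-x) = nrm x := by
  unfold nrm
  rw [AddCircle.coe_neg, norm_neg]

lemma nrm_eq (x : ℝ) : nrm x = |x - round x| := UnitAddCircle.norm_eq

lemma nrm_le_abs (x : ℝ) : nrm x ≤ |x| := by
  rw [nrm_eq]
  simpa using round_le x 0

lemma per_int {f : ℝ → E2} (hf : Function.Periodic f 1) (x : ℝ) (k : ℤ) :
    f (x + k) = f x := by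
  have := hf.int_mul k x
  simpa using this

lemma modulus {f : ℝ → E2} (hf : Function.Periodic f 1) (hc : Continuous f) {ε : ℝ} (hε : 0 < ε) :
    ∃ δ > 0, ∀ x y, nrm (x - y) < δ → ‖f x - f y‖ < ε := by
  have hF : Continuous (hf.lift : UnitAddCircle → E2) := continuous_coinduced_dom.2 hc
  haveI : Fact ((0:ℝ) < 1) := ⟨one_pos⟩
  have hu : UniformContinuous (hf.lift : UnitAddCircle → E2) :=
    CompactSpace.uniformContinuous_of_continuous hF
  rw [Metric.uniformContinuous_iff] at hu
  obtain ⟨δ, hδ, h⟩ := hu ε hε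
  refine ⟨δ, hδ, fun x y hxy => ?_⟩
  have := @h (x : UnitAddCircle) (y : UnitAddCircle) (by
    rw [dist_eq_norm, ← AddCircle.coe_sub]; exact hxy)
  rwa [Function.Periodic.lift_coe, Function.Periodic.lift_coe, dist_eq_norm] at this

lemma InN.diff {γ : ℝ → E2} (h : InN γ) : Differentiable ℝ γ :=
  h.1.1.differentiable (by norm_num)

lemma InN.cont {γ : ℝ → E2} (h : InN γ) : Continuous γ := h.diff.continuous

lemma InN.contD {γ : ℝ → E2} (h : InN γ) : Continuous (deriv γ) :=
  h.1.1.continuous_deriv (by norm_num)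

lemma InN.perD {γ : ℝ → E2} (h : InN γ) : Function.Periodic (deriv γ) 1 := by
  intro x
  rw [← deriv_comp_add_const]
  congr 1
  funext y
  exact h.1.2 y

lemma InN.lip {γ : ℝ → E2} (h : InN γ) (x y : ℝ) : ‖γ x - γ y‖ ≤ |x - y| := by
  have := Convex.norm_image_sub_le_of_norm_deriv_le (f := γ) (C := 1) (s := Set.univ)
    (x := y) (y := x) (fun z _ => h.diff z) (fun z _ => (h.2 z).le) convex_univ trivial trivial
  simpa using this

lemma InN.lipN {γ : ℝ → E2} (h : InN γ) (x y : ℝ) : ‖γ x - γ y‖ ≤ nrm (x - y) := by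
  rw [nrm_eq]
  have := h.lip x (y + round (x - y))
  rw [per_int h.1.2] at this
  convert this using 2
  ring

lemma nrm_pos_of {x : ℝ} (h : ¬ ∃ k : ℤ, x = k) : 0 < nrm x := by
  rw [nrm_eq, abs_pos]
  intro h0
  exact h ⟨round x, by linarith⟩

lemma bilip {γ : ℝ → E2} (h : InN γ) (hi : InjLoop γ) :
    ∃ m > 0, ∀ s t, m * nrm (s - t) ≤ ‖γ s - γ t‖ := by
  obtain ⟨δ, hδ, hm⟩ := modulus h.perD h.contD (ε := 1/2) (by norm_num)
  -- local
  have hloc : ∀ s t, |s - t| < δ → (1/2) * |s - t| ≤ ‖γ s - γ t‖ := by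
    intro s t hst
    have h1 := Convex.norm_image_sub_le_of_norm_hasDerivWithin_le
      (f := fun x => γ x - x • deriv γ t) (f' := fun x => deriv γ x - deriv γ t)
      (C := 1/2) (s := Set.uIcc t s) (x := t) (y := s) (fun x _ => by
        have h2 := (h.diff x).hasDerivAt.sub ((hasDerivAt_id x).smul_const (deriv γ t))
        have h3 := h2.hasDerivWithinAt (s := Set.uIcc t s)
        rw [one_smul] at h3
        exact h3)
      (fun x hx => by
        refine (hm x t ((nrm_le_abs _).trans_lt (lt_of_le_of_lt ?_ hst))).le
        exact Set.abs_sub_left_of_mem_uIcc hx)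
      (convex_uIcc _ _) Set.left_mem_uIcc Set.right_mem_uIcc
    have h3 : ‖(s - t) • deriv γ t‖ = |s - t| := by rw [norm_smul, h.2, mul_one, Real.norm_eq_abs]
    have h4 : γ s - γ t = (s - t) • deriv γ t + (γ s - s • deriv γ t - (γ t - t • deriv γ t)) := by
      module
    have h5 := norm_sub_le (γ s - γ t) (γ s - s • deriv γ t - (γ t - t • deriv γ t))
    have h6 : (γ s - γ t) - (γ s - s • deriv γ t - (γ t - t • deriv γ t)) = (s - t) • deriv γ t := by
      module
    rw [h6, h3] at h5
    rw [Real.norm_eq_abs] at h1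
    linarith
  -- far
  have hcpt : IsCompact ((Set.Icc (0:ℝ) 1 ×ˢ Set.Icc (-1/2 : ℝ) (1/2)) ∩ {p : ℝ × ℝ | δ ≤ |p.2|}) := by
    refine (isCompact_Icc.prod isCompact_Icc).inter_right ?_
    exact isClosed_le continuous_const (by fun_prop)
  have hfar : ∃ c > 0, ∀ p ∈ ((Set.Icc (0:ℝ) 1 ×ˢ Set.Icc (-1/2 : ℝ) (1/2)) ∩ {p : ℝ × ℝ | δ ≤ |p.2|}),
      c ≤ ‖γ (p.1 + p.2) - γ p.1‖ := by
    rcases Set.eq_empty_or_nonempty ((Set.Icc (0:ℝ) 1 ×ˢ Set.Icc (-1/2 : ℝ) (1/2)) ∩ {p : ℝ × ℝ | δ ≤ |p.2|}) with he | hne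
    · exact ⟨1, one_pos, fun p hp => by rw [he] at hp; exact hp.elim⟩
    · have hc := h.cont
      obtain ⟨p, hp, hmin⟩ := hcpt.exists_isMinOn hne
        (f := fun p : ℝ × ℝ => ‖γ (p.1 + p.2) - γ p.1‖) (by fun_prop)
      refine ⟨_, ?_, fun q hq => hmin hq⟩
      show 0 < ‖γ (p.1 + p.2) - γ p.1‖
      rw [norm_pos_iff, sub_ne_zero]
      intro heq
      obtain ⟨k, hk⟩ := hi _ _ heq
      have h1 := hp.1.2.1
      have h2 := hp.1.2.2
      have h3 : δ ≤ |p.2| := hp.2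
      have hk' : p.2 = k := by linarith
      have hk0 : k = 0 := by
        have a : (-1 : ℝ) < k := by linarith
        have b : (k:ℝ) < 1 := by linarith
        have a' : (-1 : ℤ) < k := by exact_mod_cast a
        have b' : k < (1:ℤ) := by exact_mod_cast b
        omega
      rw [hk', hk0] at h3
      simp at h3
      linarith
  obtain ⟨c, hc, hfar⟩ := hfar
  refine ⟨min (1/2) c, by positivity, fun s t => ?_⟩
  have hr : nrm (s - t) ≤ 1/2 := by rw [nrm_eq]; exact abs_sub_round _
  set u := s - t - round (s - t) with hu
  have hnu : nrm (s - t) = |u| := nrm_eq _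
  have hs : γ s = γ (t + u) := by
    rw [← per_int h.1.2 (t + u) (round (s - t))]
    congr 1
    rw [hu]; ring
  rw [hs]
  by_cases hd : |u| < δ
  · have := hloc (t + u) t (by simpa using hd)
    rw [add_sub_cancel_left] at this
    rw [hnu]
    refine le_trans ?_ this
    gcongr
    exact min_le_left _ _
  · have ht1 : γ (t + u) = γ (Int.fract t + u) := by
      rw [← per_int h.1.2 (Int.fract t + u) ⌊t⌋]
      congr 1
      have := Int.fract_add_floor t
      linarith
    have ht2 : γ t = γ (Int.fract t) := by
      rw [← per_int h.1.2 (Int.fract t) ⌊t⌋]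
      congr 1
      have := Int.fract_add_floor t
      linarith
    have hu2 := abs_le.1 (hnu ▸ hr)
    have := hfar (Int.fract t, u) ⟨⟨⟨Int.fract_nonneg _, (Int.fract_lt_one _).le⟩,
      ⟨by simp only; linarith [hu2.1], hu2.2⟩⟩, not_lt.1 hd⟩
    rw [ht1, ht2]
    refine le_trans ?_ this
    calc min (1/2) c * nrm (s - t) ≤ c * 1 := by
          exact mul_le_mul (min_le_right _ _) (by linarith) (nrm_nonneg _) hc.le
      _ = c := mul_one _

lemma dist_s {γ g : ℝ → E2} (h : InN γ) (hg : InN g) {m ε : ℝ} (hm : 0 < m)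
    (hb : ∀ s t, m * nrm (s - t) ≤ ‖γ s - γ t‖) {s : ℝ → ℝ}
    (hs : ∀ t, ‖g t - γ (s t)‖ ≤ ε) (t t' : ℝ) :
    nrm (s t - s t') ≤ (|t - t'| + 2 * ε) / m := by
  rw [le_div_iff₀ hm, mul_comm]
  refine (hb _ _).trans ?_
  have h1 : γ (s t) - γ (s t') = (g t - g t') - (g t - γ (s t)) + (g t' - γ (s t')) := by abel
  rw [h1]
  have := norm_add_le ((g t - g t') - (g t - γ (s t))) (g t' - γ (s t'))
  have := norm_sub_le (g t - g t') (g t - γ (s t))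
  have := hg.lip t t'
  linarith [hs t, hs t']

lemma sign {γ : ℝ → E2} (h : InN γ) (hi : InjLoop γ) :
    ∃ ε₀ > 0, ∀ ε ≤ ε₀, ∀ g, InN g → ∀ s : ℝ → ℝ, (∀ t, ‖g t - γ (s t)‖ ≤ ε) →
      (∀ t, ‖deriv g t - deriv γ (s t)‖ ≤ ε ∨ ‖deriv g t + deriv γ (s t)‖ ≤ ε) →
      (∀ t, ‖deriv g t - deriv γ (s t)‖ ≤ ε) ∨ (∀ t, ‖deriv g t + deriv γ (s t)‖ ≤ ε) := by
  obtain ⟨m, hm, hb⟩ := bilip h hi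
  obtain ⟨δ, hδ, hmod⟩ := modulus h.perD h.contD (ε := 1/4) (by norm_num)
  refine ⟨min (1/4) (m * δ / 8), by positivity, fun ε hε g hg s hs hd => ?_⟩
  have hε1 : ε ≤ 1/4 := hε.trans (min_le_left _ _)
  have hε2 : ε ≤ m * δ / 8 := hε.trans (min_le_right _ _)
  have hev : ∀ t₀, ∀ᶠ t in 𝓝 t₀, ‖deriv g t - deriv g t₀‖ < 1/4 ∧
      ‖deriv γ (s t) - deriv γ (s t₀)‖ < 1/4 := by
    intro t₀
    have e1 : ∀ᶠ t in 𝓝 t₀, dist (deriv g t) (deriv g t₀) < 1/4 :=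
      (Metric.tendsto_nhds.1 hg.contD.continuousAt) _ (by norm_num)
    have e2 : ∀ᶠ t in 𝓝 t₀, dist t t₀ < m * δ / 2 := Metric.ball_mem_nhds _ (by positivity)
    filter_upwards [e1, e2] with t h1 h2
    refine ⟨by rwa [← dist_eq_norm], hmod _ _ ((dist_s h hg hm hb hs t t₀).trans_lt ?_)⟩
    rw [div_lt_iff₀ hm]
    rw [Real.dist_eq] at h2
    nlinarith [mul_pos hm hδ]
  have key : ∀ t t₀, ‖deriv g t - deriv g t₀‖ < 1/4 → ‖deriv γ (s t) - deriv γ (s t₀)‖ < 1/4 →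
      ‖deriv g t - deriv γ (s t)‖ ≤ ε → ‖deriv g t₀ + deriv γ (s t₀)‖ ≤ ε → False := by
    intro t t₀ a b c d
    have e : (2:ℝ) • deriv γ (s t) = (deriv g t - deriv g t₀) - (deriv g t - deriv γ (s t))
      + ((deriv g t₀ + deriv γ (s t₀)) + (deriv γ (s t) - deriv γ (s t₀))) := by module
    have e2 : ‖(2:ℝ) • deriv γ (s t)‖ = 2 := by rw [norm_smul, h.2]; norm_num
    rw [e] at e2
    have := norm_add_le ((deriv g t - deriv g t₀) - (deriv g t - deriv γ (s t)))
      ((deriv g t₀ + deriv γ (s t₀)) + (deriv γ (s t) - deriv γ (s t₀)))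
    have := norm_sub_le (deriv g t - deriv g t₀) (deriv g t - deriv γ (s t))
    have := norm_add_le (deriv g t₀ + deriv γ (s t₀)) (deriv γ (s t) - deriv γ (s t₀))
    linarith
  have hclopen : IsClopen {t | ‖deriv g t - deriv γ (s t)‖ ≤ ε} := by
    constructor
    · rw [← isOpen_compl_iff, isOpen_iff_mem_nhds]
      intro t₀ ht₀
      filter_upwards [hev t₀] with t ht hA
      exact key t t₀ ht.1 ht.2 hA ((hd t₀).resolve_left ht₀)
    · rw [isOpen_iff_mem_nhds]
      intro t₀ ht₀
      filter_upwards [hev t₀] with t ht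
      by_contra hA
      exact key t₀ t (by rw [norm_sub_rev]; exact ht.1) (by rw [norm_sub_rev]; exact ht.2) ht₀
        ((hd t).resolve_left hA)
  rcases isClopen_iff.1 hclopen with he | hu
  · right
    intro t
    refine (hd t).resolve_left fun hA => ?_
    have : t ∈ {t | ‖deriv g t - deriv γ (s t)‖ ≤ ε} := hA
    rw [he] at this
    exact this
  · left
    intro t
    have : t ∈ {t | ‖deriv g t - deriv γ (s t)‖ ≤ ε} := by rw [hu]; trivial
    exact this

lemma step {γ g : ℝ → E2} (h : InN γ) (hg : InN g) {m ε κ δ η : ℝ} (hm : 0 < m)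
    (hb : ∀ s t, m * nrm (s - t) ≤ ‖γ s - γ t‖) {s : ℝ → ℝ}
    (hs : ∀ t, ‖g t - γ (s t)‖ ≤ ε) (hd : ∀ t, ‖deriv g t - deriv γ (s t)‖ ≤ ε)
    (hmod : ∀ x y, nrm (x - y) < δ → ‖deriv γ x - deriv γ y‖ < κ)
    (hη : 0 ≤ η) (hsm : (η + 2 * ε) / m + η < δ) (t : ℝ) :
    nrm (s (t + η) - s t - η) ≤ (2 * ε + (ε + κ) * η) / m := by
  have hmv := Convex.norm_image_sub_le_of_norm_hasDerivWithin_le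
      (f := fun x => g (t + x) - γ (s t + x)) (f' := fun x => deriv g (t + x) - deriv γ (s t + x))
      (C := ε + κ) (s := Set.Icc 0 η) (x := 0) (y := η) (fun x _ =>
        (((hg.diff (t + x)).hasDerivAt.comp_const_add t x).sub
          ((h.diff (s t + x)).hasDerivAt.comp_const_add (s t) x)).hasDerivWithinAt)
      (fun x hx => by
        have h1 : nrm (s (t + x) - (s t + x)) < δ := by
          have a := nrm_add_le (s (t + x) - s t) (-x)
          have b := dist_s h hg hm hb hs (t + x) t
          rw [nrm_neg] at a
          have c := nrm_le_abs x
          rw [add_sub_cancel_left] at b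
          rw [abs_of_nonneg hx.1] at b c
          have d : (x + 2 * ε) / m ≤ (η + 2 * ε) / m := by gcongr; exact hx.2
          have e : s (t + x) - (s t + x) = s (t + x) - s t + -x := by ring
          rw [e]
          linarith [hx.2]
        have e : deriv g (t + x) - deriv γ (s t + x) = (deriv g (t + x) - deriv γ (s (t + x)))
          + (deriv γ (s (t + x)) - deriv γ (s t + x)) := by abel
        rw [e]
        exact (norm_add_le _ _).trans (add_le_add (hd _) (hmod _ _ h1).le))
      (convex_Icc _ _) (Set.left_mem_Icc.2 hη) (Set.right_mem_Icc.2 hη)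
  rw [le_div_iff₀ hm, mul_comm]
  have e0 : s (t + η) - s t - η = s (t + η) - (s t + η) := by ring
  rw [e0]
  refine (hb _ _).trans ?_
  simp only [add_zero, sub_zero, Real.norm_eq_abs, abs_of_nonneg hη] at hmv
  have e : γ (s (t + η)) - γ (s t + η) = (g (t + η) - γ (s t + η) - (g t - γ (s t)))
    + (g t - γ (s t)) - (g (t + η) - γ (s (t + η))) := by abel
  rw [e]
  have := norm_sub_le ((g (t + η) - γ (s t + η) - (g t - γ (s t)))
    + (g t - γ (s t))) (g (t + η) - γ (s (t + η)))
  have := norm_add_le (g (t + η) - γ (s t + η) - (g t - γ (s t))) (g t - γ (s t))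
  linarith [hs t, hs (t + η)]

lemma track {γ : ℝ → E2} (h : InN γ) (hi : InjLoop γ) {η : ℝ} (hη : 0 < η) :
    ∃ ε₀ > 0, ∀ ε ≤ ε₀, ∀ g, InN g → ∀ s : ℝ → ℝ, (∀ t, ‖g t - γ (s t)‖ ≤ ε) →
      (∀ t, ‖deriv g t - deriv γ (s t)‖ ≤ ε) →
      ∀ t, 0 ≤ t → t ≤ 1 → nrm (s t - s 0 - t) ≤ η := by
  obtain ⟨m, hm, hb⟩ := bilip h hi
  obtain ⟨δ, hδ, hmod⟩ := modulus h.perD h.contD (ε := m * η / 2) (by positivity)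
  obtain ⟨n, hn⟩ := exists_nat_gt ((1 / m + 1) / (δ / 2))
  have hn0 : (0:ℝ) < n := lt_trans (by positivity) hn
  refine ⟨min (m * δ / 8) (m * η / (2 * (2 * n + 1))), by positivity, fun ε hε g hg s hs hd t ht ht1 => ?_⟩
  have hε1 := hε.trans (min_le_left _ _)
  have hε2 := hε.trans (min_le_right _ _)
  have hε0 : 0 ≤ ε := (norm_nonneg _).trans (hs 0)
  set u := t / n with hu
  have hu0 : 0 ≤ u := by positivity
  have hnu : n * u = t := by rw [hu]; field_simp
  have hsm : (u + 2 * ε) / m + u < δ := by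
    rw [div_lt_iff₀ (by positivity)] at hn
    have a : u ≤ 1 / n := by rw [hu]; gcongr
    have b : (1 / m + 1) * (1 / n) < δ / 2 := by
      rw [mul_one_div, div_lt_iff₀ hn0]; linarith
    have c : (1 / m + 1) * u ≤ (1 / m + 1) * (1 / n) := by gcongr
    have d : 2 * ε / m ≤ δ / 4 := by rw [div_le_iff₀ hm]; linarith
    have e : (u + 2 * ε) / m + u = (1 / m + 1) * u + 2 * ε / m := by ring
    linarith
  have hind : ∀ j : ℕ, nrm (s (j * u) - s 0 - j * u) ≤ j * ((2 * ε + (ε + m * η / 2) * u) / m) := by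
    intro j
    induction j with
    | zero => simp [nrm]
    | succ j ih =>
      have a := step h hg hm hb hs hd hmod hu0 hsm (j * u)
      have b := nrm_add_le (s (j * u) - s 0 - j * u) (s (j * u + u) - s (j * u) - u)
      have e1 : ((j + 1 : ℕ) : ℝ) * u = j * u + u := by push_cast; ring
      rw [e1]
      have e2 : s (j * u + u) - s 0 - (j * u + u) =
        (s (j * u) - s 0 - j * u) + (s (j * u + u) - s (j * u) - u) := by ring
      rw [e2]
      push_cast
      linarith
  have := hind n
  rw [hnu] at this
  refine this.trans ?_
  rw [← mul_div_assoc, div_le_iff₀ hm]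
  rw [le_div_iff₀ (by positivity)] at hε2
  have e : n * (2 * ε + (ε + m * η / 2) * u) = 2 * n * ε + (ε + m * η / 2) * t := by
    rw [← hnu]; ring
  rw [e]
  have : (ε + m * η / 2) * t ≤ (ε + m * η / 2) * 1 := by gcongr
  nlinarith


lemma rel_deriv {g γ : ℝ → E2} (h : InN γ) {ε c : ℝ} (hr : ∀ t, g t = γ (ε * t + c)) (t : ℝ) :
    HasDerivAt g (ε • deriv γ (ε * t + c)) t := by
  have h1 : HasDerivAt (fun t : ℝ => ε * t + c) ε t := by
    simpa using ((hasDerivAt_id t).const_mul ε).add_const c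
  have h2 := (h.diff (ε * t + c)).hasDerivAt.scomp t h1
  have : g = γ ∘ fun t : ℝ => ε * t + c := funext hr
  rw [this]
  exact h2

lemma rel_InN {g γ : ℝ → E2} (h : InN γ) (hr : LoopRel g γ) : InN g := by
  obtain ⟨ε, c, hε, hr⟩ := hr
  have hg : g = fun t => γ (ε * t + c) := funext hr
  refine ⟨⟨?_, ?_⟩, fun t => ?_⟩
  · rw [hg]
    have := h.1.1
    fun_prop
  · intro t
    rw [hr, hr]
    rcases hε with rfl | rfl
    · have := per_int h.1.2 (1 * t + c) 1
      rw [← this]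
      congr 1
      push_cast; ring
    · have := per_int h.1.2 (-1 * t + c) (-1)
      rw [← this]
      congr 1
      push_cast; ring
  · rw [(rel_deriv h hr t).deriv, norm_smul, h.2]
    rcases hε with rfl | rfl <;> simp

lemma mem_K {γ : ℝ → E2} {p : E2 × E2} :
    p ∈ Kset γ ↔ ∃ t : ℝ, p.1 = γ t ∧ (p.2 = deriv γ t ∨ p.2 = -deriv γ t) := by
  constructor
  · rintro (⟨t, rfl⟩ | ⟨t, rfl⟩)
    · exact ⟨t, rfl, Or.inl rfl⟩
    · exact ⟨t, rfl, Or.inr rfl⟩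
  · rintro ⟨t, h1, h2 | h2⟩
    · exact Or.inl ⟨t, Prod.ext h1 h2⟩
    · exact Or.inr ⟨t, Prod.ext h1 h2⟩

lemma rel_K {g γ : ℝ → E2} (h : InN γ) (hr : LoopRel g γ) : Kset g = Kset γ := by
  obtain ⟨ε, c, hε, hr⟩ := hr
  ext p
  rw [mem_K, mem_K]
  constructor
  · rintro ⟨t, h1, h2⟩
    refine ⟨ε * t + c, by rw [h1, hr], ?_⟩
    rw [(rel_deriv h hr t).deriv] at h2
    rcases hε with rfl | rfl
    · simpa using h2
    · simpa [or_comm] using h2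
  · rintro ⟨t, h1, h2⟩
    have e : ε * (ε * (t - c)) + c = t := by
      rcases hε with rfl | rfl <;> ring
    refine ⟨ε * (t - c), by rw [h1, hr, e], ?_⟩
    rw [(rel_deriv h hr _).deriv, e]
    rcases hε with rfl | rfl
    · simpa using h2
    · simpa [or_comm] using h2

lemma InN.bdd {γ : ℝ → E2} (h : InN γ) (t : ℝ) : ‖γ t‖ ≤ ‖γ 0‖ + 1 := by
  have h1 := h.lipN t 0
  have hr : nrm (t - 0) ≤ 1/2 := by rw [nrm_eq]; exact abs_sub_round _
  have := norm_le_norm_add_norm_sub' (γ t) (γ 0)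
  linarith

lemma bddA {g₁ g₂ : ℝ → E2} (h₁ : InN g₁) (h₂ : InN g₂) :
    BddAbove (Set.range fun t : ℝ => dist (g₁ t) (g₂ t)) := by
  refine ⟨(‖g₁ 0‖ + 1) + (‖g₂ 0‖ + 1), ?_⟩
  rintro _ ⟨t, rfl⟩
  simp only [dist_eq_norm]
  exact (norm_sub_le _ _).trans (add_le_add (h₁.bdd t) (h₂.bdd t))

lemma bddB {g₁ g₂ : ℝ → E2} (h₁ : InN g₁) (h₂ : InN g₂) :
    BddAbove (Set.range fun t : ℝ => dist (deriv g₁ t) (deriv g₂ t)) := by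
  refine ⟨1 + 1, ?_⟩
  rintro _ ⟨t, rfl⟩
  simp only [dist_eq_norm]
  exact (norm_sub_le _ _).trans (add_le_add (h₁.2 t).le (h₂.2 t).le)

lemma dC1_nonneg (g₁ g₂ : ℝ → E2) : 0 ≤ dC1 g₁ g₂ :=
  add_nonneg (Real.iSup_nonneg fun _ => dist_nonneg) (Real.iSup_nonneg fun _ => dist_nonneg)

lemma dC1_ge {g₁ g₂ : ℝ → E2} (h₁ : InN g₁) (h₂ : InN g₂) (t : ℝ) :
    dist (g₁ t) (g₂ t) ≤ dC1 g₁ g₂ ∧ dist (deriv g₁ t) (deriv g₂ t) ≤ dC1 g₁ g₂ := by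
  have a := le_ciSup (bddA h₁ h₂) t
  have b := le_ciSup (bddB h₁ h₂) t
  have a' : 0 ≤ ⨆ t : ℝ, dist (g₁ t) (g₂ t) := Real.iSup_nonneg fun _ => dist_nonneg
  have b' : 0 ≤ ⨆ t : ℝ, dist (deriv g₁ t) (deriv g₂ t) := Real.iSup_nonneg fun _ => dist_nonneg
  unfold dC1
  constructor <;> linarith

lemma half_H {g₁ g₂ : ℝ → E2} {r : ℝ} (hr : ∀ t, dist (g₁ t) (g₂ t) ≤ r ∧
    dist (deriv g₁ t) (deriv g₂ t) ≤ r) : ∀ x ∈ Kset g₁, ∃ y ∈ Kset g₂, dist x y ≤ r := by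
  intro x hx
  obtain ⟨t, h1, h2 | h2⟩ := mem_K.1 hx
  · refine ⟨(g₂ t, deriv g₂ t), mem_K.2 ⟨t, rfl, Or.inl rfl⟩, ?_⟩
    rw [Prod.dist_eq, h1, h2]
    exact max_le (hr t).1 (hr t).2
  · refine ⟨(g₂ t, -deriv g₂ t), mem_K.2 ⟨t, rfl, Or.inr rfl⟩, ?_⟩
    rw [Prod.dist_eq, h1, h2, dist_neg_neg]
    exact max_le (hr t).1 (hr t).2

lemma H_le {g₁ g₂ : ℝ → E2} (h₁ : InN g₁) (h₂ : InN g₂) :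
    Metric.hausdorffDist (Kset g₁) (Kset g₂) ≤ dC1 g₁ g₂ := by
  refine Metric.hausdorffDist_le_of_mem_dist (dC1_nonneg _ _) (half_H (dC1_ge h₁ h₂)) ?_
  refine half_H fun t => ?_
  rw [dist_comm, dist_comm (deriv g₂ t)]
  exact dC1_ge h₁ h₂ t

lemma LoopRel.refl' (γ : ℝ → E2) : LoopRel γ γ := ⟨1, 0, Or.inl rfl, fun t => by simp⟩

lemma H_le_delta {γ₁ γ₂ : ℝ → E2} (h₁ : InN γ₁) (h₂ : InN γ₂) :
    Metric.hausdorffDist (Kset γ₁) (Kset γ₂) ≤ deltaDist γ₁ γ₂ := by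
  refine le_csInf ⟨_, γ₁, γ₂, LoopRel.refl' _, LoopRel.refl' _, rfl⟩ ?_
  rintro r ⟨g₁, g₂, hr₁, hr₂, rfl⟩
  rw [← rel_K h₁ hr₁, ← rel_K h₂ hr₂]
  exact H_le (rel_InN h₁ hr₁) (rel_InN h₂ hr₂)

lemma delta_nonneg (γ₁ γ₂ : ℝ → E2) : 0 ≤ deltaDist γ₁ γ₂ := by
  refine Real.sInf_nonneg ?_
  rintro r ⟨g₁, g₂, -, -, rfl⟩
  exact dC1_nonneg _ _

lemma delta_le {γ₁ γ₂ g₁ g₂ : ℝ → E2} (h₁ : LoopRel g₁ γ₁) (h₂ : LoopRel g₂ γ₂) :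
    deltaDist γ₁ γ₂ ≤ dC1 g₁ g₂ := by
  refine csInf_le ⟨0, ?_⟩ ⟨g₁, g₂, h₁, h₂, rfl⟩
  rintro r ⟨g₁, g₂, -, -, rfl⟩
  exact dC1_nonneg _ _

lemma K_bdd {γ : ℝ → E2} (h : InN γ) : Bornology.IsBounded (Kset γ) := by
  rw [isBounded_iff_forall_norm_le]
  refine ⟨max (‖γ 0‖ + 1) 1, fun p hp => ?_⟩
  obtain ⟨t, h1, h2⟩ := mem_K.1 hp
  rw [Prod.norm_def]
  refine max_le_max (h1 ▸ h.bdd t) ?_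
  rcases h2 with h2 | h2
  · rw [h2, h.2]
  · rw [h2, norm_neg, h.2]

lemma K_ne (γ : ℝ → E2) : (Kset γ).Nonempty := ⟨(γ 0, deriv γ 0), mem_K.2 ⟨0, rfl, Or.inl rfl⟩⟩

lemma close_plus {γ : ℝ → E2} (h : InN γ) (hi : InjLoop γ) {r : ℝ} (hr : 0 < r) :
    ∃ ε₀ > 0, ∀ ε ≤ ε₀, ∀ g, InN g → ∀ s : ℝ → ℝ, (∀ t, ‖g t - γ (s t)‖ ≤ ε) →
      (∀ t, ‖deriv g t - deriv γ (s t)‖ ≤ ε) →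
      dC1 g (fun t => γ (1 * t + s 0)) ≤ r := by
  obtain ⟨δ, hδ, hmod⟩ := modulus h.perD h.contD (ε := r / 4) (by positivity)
  obtain ⟨ε₁, hε₁, ht⟩ := track h hi (η := min (r / 4) (δ / 2)) (by positivity)
  refine ⟨min ε₁ (r / 4), by positivity, fun ε hε g hg s hs hd => ?_⟩
  have hεr := hε.trans (min_le_right _ _)
  have ht := ht ε (hε.trans (min_le_left _ _)) g hg s hs hd
  have hrel : ∀ t, (fun t => γ (1 * t + s 0)) t = γ (1 * t + s 0) := fun _ => rfl
  have key : ∀ t, dist (g t) (γ (1 * t + s 0)) ≤ r / 2 ∧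
      dist (deriv g t) (deriv γ (1 * t + s 0)) ≤ r / 2 := by
    intro t
    have hft := Int.fract_add_floor t
    have e1 : g t = g (Int.fract t) := by
      rw [← per_int hg.1.2 (Int.fract t) ⌊t⌋, hft]
    have e2 : deriv g t = deriv g (Int.fract t) := by
      rw [← per_int hg.perD (Int.fract t) ⌊t⌋, hft]
    have e0 : 1 * t + s 0 = (Int.fract t + s 0) + ⌊t⌋ := by linarith
    rw [e0, per_int h.1.2, per_int h.perD, e1, e2]
    generalize hx : Int.fract t = x
    have hb := ht x (hx ▸ Int.fract_nonneg _) (hx ▸ (Int.fract_lt_one _).le)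
    have e3 : s x - s 0 - x = s x - (x + s 0) := by ring
    rw [e3] at hb
    have hb1 := hb.trans (min_le_left _ _)
    have hb2 := hb.trans (min_le_right _ _)
    have l1 := (h.lipN (s x) (x + s 0)).trans hb1
    have l2 := hmod (s x) (x + s 0) (by linarith)
    rw [dist_eq_norm, dist_eq_norm]
    constructor
    · have := norm_sub_le_norm_sub_add_norm_sub (g x) (γ (s x)) (γ (x + s 0))
      linarith [hs x]
    · have := norm_sub_le_norm_sub_add_norm_sub (deriv g x) (deriv γ (s x)) (deriv γ (x + s 0))
      linarith [hd x]
  unfold dC1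
  have a : (⨆ t : ℝ, dist (g t) (γ (1 * t + s 0))) ≤ r / 2 := ciSup_le fun t => (key t).1
  have b : (⨆ t : ℝ, dist (deriv g t) (deriv (fun t => γ (1 * t + s 0)) t)) ≤ r / 2 := by
    refine ciSup_le fun t => ?_
    rw [(rel_deriv h hrel t).deriv, one_smul]
    exact (key t).2
  linarith

lemma close {γ : ℝ → E2} (h : InN γ) (hi : InjLoop γ) {r : ℝ} (hr : 0 < r) :
    ∃ ε > 0, ∀ g, InN g → Metric.hausdorffDist (Kset g) (Kset γ) < ε → deltaDist g γ ≤ r := by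
  obtain ⟨ε₁, hε₁, h1⟩ := sign h hi
  obtain ⟨ε₂, hε₂, h2⟩ := close_plus h hi hr
  refine ⟨min ε₁ ε₂, by positivity, fun g hg hH => ?_⟩
  set ε := min ε₁ ε₂ with hε
  have hex : ∀ t, ∃ s : ℝ, ‖g t - γ s‖ ≤ ε ∧
      (‖deriv g t - deriv γ s‖ ≤ ε ∨ ‖deriv g t + deriv γ s‖ ≤ ε) := by
    intro t
    obtain ⟨y, hy, hd⟩ := Metric.exists_dist_lt_of_hausdorffDist_lt
      (x := (g t, deriv g t)) (mem_K.2 ⟨t, rfl, Or.inl rfl⟩) hH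
      (Metric.hausdorffEDist_ne_top_of_nonempty_of_bounded (K_ne g) (K_ne γ) (K_bdd hg) (K_bdd h))
    obtain ⟨s, hs1, hs2⟩ := mem_K.1 hy
    rw [Prod.dist_eq, max_lt_iff, dist_eq_norm, dist_eq_norm] at hd
    refine ⟨s, hs1 ▸ hd.1.le, ?_⟩
    rcases hs2 with hs2 | hs2
    · left; exact hs2 ▸ hd.2.le
    · right
      have := hd.2.le
      rw [hs2] at this
      simpa using this
  choose s hs hd using hex
  have hrelγ : ∀ c, LoopRel (fun t => γ (1 * t + c)) γ := fun c => ⟨1, c, Or.inl rfl, fun _ => rfl⟩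
  rcases h1 ε (min_le_left _ _) g hg s hs hd with hp | hn
  · exact (delta_le (LoopRel.refl' g) (hrelγ _)).trans (h2 ε (min_le_right _ _) g hg s hs hp)
  · have hrel : LoopRel (fun t => g (-1 * t + 0)) g := ⟨-1, 0, Or.inr rfl, fun _ => rfl⟩
    refine (delta_le hrel (hrelγ _)).trans (h2 ε (min_le_right _ _) _ (rel_InN hg hrel)
      (fun t => s (-1 * t + 0)) (fun t => hs _) fun t => ?_)
    rw [(rel_deriv hg (g := fun t => g (-1 * t + 0)) (fun _ => rfl) t).deriv]
    have := hn (-1 * t + 0)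
    rw [← norm_neg] at this
    have e : (-1 : ℝ) • deriv g (-1 * t + 0) - deriv γ (s (-1 * t + 0)) =
        -(deriv g (-1 * t + 0) + deriv γ (s (-1 * t + 0))) := by module
    rw [e]
    exact this

/-- For injective unit-speed `C¹` loops, convergence in the quotient distance `δ` is
equivalent to convergence of the unitary tangent bundles in the Hausdorff distance;
hence `α(B₁, B₂) = d_H(K(B₁), K(B₂))` is topologically equivalent to `δ`. -/
theorem stmt6 (γ : ℝ → EuclideanSpace ℝ (Fin 2))
    (γs : ℕ → ℝ → EuclideanSpace ℝ (Fin 2))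
    (hγ : InN γ) (hγinj : InjLoop γ)
    (hγs : ∀ k, InN (γs k)) (hγsinj : ∀ k, InjLoop (γs k)) :
    Tendsto (fun k => deltaDist (γs k) γ) atTop (𝓝 0) ↔
      Tendsto (fun k => Metric.hausdorffDist (Kset (γs k)) (Kset γ)) atTop (𝓝 0) := by
  constructor
  · intro hT
    exact squeeze_zero (fun _ => Metric.hausdorffDist_nonneg)
      (fun k => H_le_delta (hγs k) hγ) hT
  · intro hT
    rw [Metric.tendsto_nhds] at hT ⊢
    intro r hr
    obtain ⟨ε, hε, hc⟩ := close hγ hγinj (half_pos hr)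
    filter_upwards [hT ε hε] with k hk
    rw [Real.dist_eq, sub_zero, abs_of_nonneg Metric.hausdorffDist_nonneg] at hk
    rw [Real.dist_eq, sub_zero, abs_of_nonneg (delta_nonneg _ _)]
    linarith [hc _ (hγs k) hk]
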